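/- arXiv:2404.12946 — 3 statements merged into one kernel-verified Lean document; each statement's English description precedes it below -/
import Mathlib

section
/- Let T be an (α,β)-RK operator on a complex Banach space X with α > 1 and β ≥ 0. Then ‖T^n‖ = O(n^{α+β−1}), i.e. there exists a constant M > 0 such that ‖T^n‖ ≤ M n^{α+β−1} for all n ∈ ℕ. -/
/-- A bounded linear operator `T` on a complex Banach space is `(α,β)`-RK with constant `C` if
`C ≥ 1` and for every `λ ∈ ℂ` with `|λ| > 1` the operator `λI − T` is invertible with
`‖(λI − T)⁻¹‖ ≤ C |λ|^(α+β−1) / (|λ−1|^α (|λ|−1)^β)`. -/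
def IsRK {X : Type*} [NormedAddCommGroup X] [NormedSpace ℂ X]
    (T : X →L[ℂ] X) (α β C : ℝ) : Prop :=
  1 ≤ C ∧ ∀ lam : ℂ, 1 < ‖lam‖ →
    IsUnit (algebraMap ℂ (X →L[ℂ] X) lam - T) ∧
    ‖Ring.inverse (algebraMap ℂ (X →L[ℂ] X) lam - T)‖ ≤
      C * ‖lam‖ ^ (α + β - 1) / (‖lam - 1‖ ^ α * (‖lam‖ - 1) ^ β)

theorem sq_norm_one_sub_circleMap (r θ : ℝ) :
    ‖1 - circleMap 0 r θ‖ ^ 2 = (1 - r) ^ 2 + 2 * r * (1 - Real.cos θ) := by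
  rw [← Complex.normSq_eq_norm_sq, Complex.normSq_apply]
  simp [circleMap, Complex.exp_ofReal_mul_I_re, Complex.exp_ofReal_mul_I_im]
  linear_combination r ^ 2 * Real.sin_sq_add_cos_sq θ

theorem le_norm_one_sub_circleMap {r θ : ℝ} (hr : 1 / 2 ≤ r) (hθ : |θ| ≤ Real.pi) :
    (1 - r + |θ|) / 3 ≤ ‖1 - circleMap 0 r θ‖ := by
  refine le_of_sq_le_sq ?_ (norm_nonneg _)
  rw [sq_norm_one_sub_circleMap]
  have hcos := Real.cos_le_one_sub_mul_cos_sq hθ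
  have hpi : (1 : ℝ) / 8 ≤ 2 / Real.pi ^ 2 := by
    rw [div_le_div_iff₀ (by norm_num) (by positivity)]
    nlinarith [Real.pi_le_four, Real.pi_pos]
  have hquad : |θ| ^ 2 / 8 ≤ 1 - Real.cos θ := by
    rw [sq_abs]
    nlinarith [mul_le_mul_of_nonneg_right hpi (sq_nonneg θ)]
  have hmul : 1 - Real.cos θ ≤ 2 * r * (1 - Real.cos θ) := by
    nlinarith [Real.cos_le_one θ]
  nlinarith [sq_nonneg (8 * (1 - r) - |θ|)]

theorem rpow_neg_norm_one_sub_circleMap_le {r θ α : ℝ} (hr : 1 / 2 ≤ r) (hr1 : r < 1)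
    (hα : 0 ≤ α) (hθ : θ ∈ Set.Icc 0 (2 * Real.pi)) :
    ‖1 - circleMap 0 r θ‖ ^ (-α) ≤
      3 ^ α * ((1 - r + θ) ^ (-α) + (1 - r + (2 * Real.pi - θ)) ^ (-α)) := by
  obtain ⟨h0, h1⟩ := hθ
  have key : ∀ φ : ℝ, |φ| ≤ Real.pi →
      ‖1 - circleMap 0 r φ‖ ^ (-α) ≤ 3 ^ α * (1 - r + |φ|) ^ (-α) := by
    intro φ hφ
    have hpos : 0 < 1 - r + |φ| := by linarith [abs_nonneg φ]
    calc ‖1 - circleMap 0 r φ‖ ^ (-α) ≤ ((1 - r + |φ|) / 3) ^ (-α) :=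
          Real.rpow_le_rpow_of_nonpos (by positivity) (le_norm_one_sub_circleMap hr hφ)
            (by linarith)
      _ = 3 ^ α * (1 - r + |φ|) ^ (-α) := by
          rw [Real.div_rpow hpos.le (by norm_num), Real.rpow_neg (by norm_num : (0 : ℝ) ≤ 3),
            div_inv_eq_mul, mul_comm]
  have hA : 0 ≤ (1 - r + θ) ^ (-α) := Real.rpow_nonneg (by linarith) _
  have hB : 0 ≤ (1 - r + (2 * Real.pi - θ)) ^ (-α) := Real.rpow_nonneg (by linarith) _
  rcases le_total θ Real.pi with h | h
  · have := key θ (by rwa [abs_of_nonneg h0])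
    rw [abs_of_nonneg h0] at this
    exact this.trans (mul_le_mul_of_nonneg_left (by linarith) (by positivity))
  · have habs : |θ - 2 * Real.pi| = 2 * Real.pi - θ := by
      rw [abs_sub_comm, abs_of_nonneg (by linarith)]
    have := key (θ - 2 * Real.pi) (by rw [habs]; linarith)
    rw [habs, (periodic_circleMap 0 r).sub_eq] at this
    exact this.trans (mul_le_mul_of_nonneg_left (by linarith) (by positivity))

theorem integral_rpow_neg_le {a b α : ℝ} (ha : 0 < a) (hab : a ≤ b) (hα : 1 < α) :
    ∫ x in a..b, x ^ (-α) ≤ a ^ (1 - α) / (α - 1) := by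
  rw [integral_rpow (Or.inr ⟨by linarith, Set.notMem_uIcc_of_lt ha (ha.trans_le hab)⟩),
    show -α + 1 = 1 - α by ring, ← neg_div_neg_eq, neg_sub, neg_sub]
  exact div_le_div_of_nonneg_right
    (sub_le_self _ (Real.rpow_nonneg (ha.le.trans hab) _)) (by linarith)

section

variable {X : Type*} [NormedAddCommGroup X] [NormedSpace ℂ X] {T : X →L[ℂ] X} {α β C : ℝ}

theorem one_sub_smul_eq_smul {z : ℂ} (hz : z ≠ 0) :
    1 - z • T = z • (algebraMap ℂ (X →L[ℂ] X) z⁻¹ - T) := by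
  rw [smul_sub, Algebra.algebraMap_eq_smul_one, smul_inv_smul₀ hz]

theorem IsRK.isUnit_one_sub_smul (hT : IsRK T α β C) {z : ℂ} (hz : ‖z‖ < 1) :
    IsUnit (1 - z • T) := by
  rcases eq_or_ne z 0 with rfl | h0
  · simp
  · rw [one_sub_smul_eq_smul h0, Algebra.smul_def]
    refine ((IsUnit.mk0 z h0).map (algebraMap ℂ (X →L[ℂ] X))).mul (hT.2 z⁻¹ ?_).1
    rw [norm_inv]
    exact (one_lt_inv₀ (norm_pos_iff.2 h0)).2 hz

theorem IsRK.norm_inverse_one_sub_smul_le (hT : IsRK T α β C) {z : ℂ} (h0 : z ≠ 0)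
    (hz : ‖z‖ < 1) :
    ‖Ring.inverse (1 - z • T)‖ ≤ C * (1 - ‖z‖) ^ (-β) * ‖1 - z‖ ^ (-α) := by
  have ht : 0 < ‖z‖ := norm_pos_iff.2 h0
  obtain ⟨-, hle⟩ := hT.2 z⁻¹ (by rw [norm_inv]; exact (one_lt_inv₀ ht).2 hz)
  have hinv : Ring.inverse (1 - z • T) =
      z⁻¹ • Ring.inverse (algebraMap ℂ (X →L[ℂ] X) z⁻¹ - T) := by
    rw [one_sub_smul_eq_smul h0, Algebra.smul_def,
      Ring.mul_inverse_rev' (Algebra.commute_algebraMap_left z _), Algebra.smul_def, Algebra.commutes]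
    congr 1
    rw [← mul_one (Ring.inverse _), Ring.inverse_mul_eq_iff_eq_mul _ _ _
      ((IsUnit.mk0 z h0).map (algebraMap ℂ (X →L[ℂ] X))), ← map_mul, mul_inv_cancel₀ h0, map_one]
  have hsub : ‖z⁻¹ - 1‖ = ‖1 - z‖ / ‖z‖ := by
    rw [← norm_div, sub_div, div_self h0, one_div]
  have hsub' : ‖z‖⁻¹ - 1 = (1 - ‖z‖) / ‖z‖ := by
    rw [sub_div, div_self ht.ne', one_div]
  rw [hsub, norm_inv, hsub', Real.inv_rpow ht.le, Real.rpow_sub ht, Real.rpow_add ht,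
    Real.rpow_one, Real.div_rpow (norm_nonneg _) ht.le, Real.div_rpow (by linarith) ht.le] at hle
  rw [hinv, norm_smul, norm_inv]
  refine (mul_le_mul_of_nonneg_left hle (by positivity)).trans_eq ?_
  rw [Real.rpow_neg (by linarith), Real.rpow_neg (norm_nonneg _)]
  have hα := Real.rpow_pos_of_pos ht α
  have hβ := Real.rpow_pos_of_pos ht β
  field_simp

theorem IsRK.norm_pow_le_integral [CompleteSpace X] (hT : IsRK T α β C) {r : ℝ} (h0 : 0 < r)
    (h1 : r < 1) (n : ℕ) :
    ‖T ^ n‖ ≤ ((2 * Real.pi)⁻¹ * ∫ θ in 0..2 * Real.pi,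
      ‖Ring.inverse (1 - circleMap 0 r θ • T)‖) * r⁻¹ ^ n := by
  lift r to NNReal using h0.le
  have hd : DifferentiableOn ℂ (fun z : ℂ => Ring.inverse (1 - z • T))
      (Metric.closedBall 0 r) := by
    intro z hz
    have hu : IsUnit (1 - z • T) :=
      hT.isUnit_one_sub_smul ((mem_closedBall_zero_iff.1 hz).trans_lt h1)
    exact (DifferentiableAt.comp (f := fun z : ℂ => 1 - z • T) z (differentiableAt_inverse hu)
      (by fun_prop)).differentiableWithinAt
  have heq := (spectrum.hasFPowerSeriesOnBall_inverse_one_sub_smul ℂ T).hasFPowerSeriesAt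
    |>.eq_formalMultilinearSeries
      (hd.hasFPowerSeriesOnBall (NNReal.coe_pos.1 h0)).hasFPowerSeriesAt
  have hle := norm_cauchyPowerSeries_le (fun z : ℂ => Ring.inverse (1 - z • T)) 0 r n
  rwa [← heq, ContinuousMultilinearMap.norm_mkPiRing, abs_of_pos h0] at hle

theorem IsRK.integral_norm_inverse_le (hT : IsRK T α β C) (hα : 1 < α) {r : ℝ}
    (hr : 1 / 2 ≤ r) (hr1 : r < 1) :
    ∫ θ in 0..2 * Real.pi, ‖Ring.inverse (1 - circleMap 0 r θ • T)‖ ≤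
      C * (2 * 3 ^ α / (α - 1)) * ((1 - r) ^ (-β) * (1 - r) ^ (1 - α)) := by
  have hC : 0 ≤ C := zero_le_one.trans hT.1
  have hpi := Real.pi_pos
  have hδ : 0 < 1 - r := by linarith
  have hnorm : ∀ θ, ‖circleMap 0 r θ‖ = r := fun θ => by
    rw [norm_circleMap_zero, abs_of_pos (by linarith)]
  set K := C * (1 - r) ^ (-β) * 3 ^ α with hK
  have hK0 : 0 ≤ K := by positivity
  have hint₁ : IntervalIntegrable (fun θ => (1 - r + θ) ^ (-α)) MeasureTheory.volume
      0 (2 * Real.pi) := by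
    refine ContinuousOn.intervalIntegrable_of_Icc (by positivity) fun θ hθ => ?_
    exact ContinuousAt.continuousWithinAt <|
      ContinuousAt.rpow_const (by fun_prop) (Or.inl (by linarith [hθ.1]))
  have hint₂ : IntervalIntegrable (fun θ => (1 - r + (2 * Real.pi - θ)) ^ (-α))
      MeasureTheory.volume 0 (2 * Real.pi) := by
    refine ContinuousOn.intervalIntegrable_of_Icc (by positivity) fun θ hθ => ?_
    exact ContinuousAt.continuousWithinAt <|
      ContinuousAt.rpow_const (by fun_prop) (Or.inl (by linarith [hθ.2]))
  have hI₁ : ∫ θ in 0..2 * Real.pi, (1 - r + θ) ^ (-α) ≤ (1 - r) ^ (1 - α) / (α - 1) := by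
    rw [intervalIntegral.integral_comp_add_left (fun x => x ^ (-α)), add_zero]
    exact integral_rpow_neg_le hδ (by linarith) hα
  have hI₂ : ∫ θ in 0..2 * Real.pi, (1 - r + (2 * Real.pi - θ)) ^ (-α) ≤
      (1 - r) ^ (1 - α) / (α - 1) := by
    rw [intervalIntegral.integral_comp_sub_left (fun x => (1 - r + x) ^ (-α)), sub_self, sub_zero]
    exact hI₁
  have hbound : ∀ θ ∈ Set.Ioc 0 (2 * Real.pi), ‖‖Ring.inverse (1 - circleMap 0 r θ • T)‖‖ ≤
      K * ((1 - r + θ) ^ (-α) + (1 - r + (2 * Real.pi - θ)) ^ (-α)) := by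
    intro θ hθ
    have h := hT.norm_inverse_one_sub_smul_le (circleMap_ne_center (by linarith) : _ ≠ (0 : ℂ))
      ((hnorm θ).trans_lt hr1)
    rw [hnorm] at h
    rw [norm_norm, hK, mul_assoc _ ((3 : ℝ) ^ α)]
    exact h.trans (mul_le_mul_of_nonneg_left (rpow_neg_norm_one_sub_circleMap_le hr hr1
      (by linarith) (Set.Ioc_subset_Icc_self hθ)) (by positivity))
  calc ∫ θ in 0..2 * Real.pi, ‖Ring.inverse (1 - circleMap 0 r θ • T)‖
      ≤ ∫ θ in 0..2 * Real.pi,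
          K * ((1 - r + θ) ^ (-α) + (1 - r + (2 * Real.pi - θ)) ^ (-α)) :=
        (Real.le_norm_self _).trans <| intervalIntegral.norm_integral_le_of_norm_le (by positivity)
          (Filter.Eventually.of_forall hbound) ((hint₁.add hint₂).const_mul K)
    _ ≤ K * ((1 - r) ^ (1 - α) / (α - 1) + (1 - r) ^ (1 - α) / (α - 1)) := by
        rw [intervalIntegral.integral_const_mul, intervalIntegral.integral_add hint₁ hint₂]
        gcongr
    _ = C * (2 * 3 ^ α / (α - 1)) * ((1 - r) ^ (-β) * (1 - r) ^ (1 - α)) := by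
        rw [hK]; ring

end


/-- For an `(α,β)`-RK operator with `α > 1` and `β ≥ 0`, `‖T^n‖ = O(n^(α+β−1))`. -/
theorem power_norm_O_sum_sub_one
    {X : Type*} [NormedAddCommGroup X] [NormedSpace ℂ X] [CompleteSpace X]
    (T : X →L[ℂ] X) (α β C : ℝ) (hα : 1 < α) (hβ : 0 ≤ β) (hT : IsRK T α β C) :
    ∃ M > (0 : ℝ), ∀ n : ℕ, 1 ≤ n → ‖T ^ n‖ ≤ M * (n : ℝ) ^ (α + β - 1) := by
  have hC : 0 < C := zero_lt_one.trans_le hT.1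
  have hα' : 0 < α - 1 := by linarith
  refine ⟨(2 * Real.pi)⁻¹ * (C * (2 * 3 ^ α / (α - 1))) * Real.exp 1 * 2 ^ (α + β - 1),
    by positivity, fun n hn => ?_⟩
  have hn1 : (1 : ℝ) ≤ n := by exact_mod_cast hn
  set r : ℝ := n / (n + 1) with hr_def
  have hδ : 1 - r = ((n : ℝ) + 1)⁻¹ := by rw [hr_def]; field_simp; ring
  have hr : 1 / 2 ≤ r := by
    rw [hr_def, div_le_div_iff₀ (by norm_num) (by positivity)]; linarith
  have hr1 : r < 1 := by
    have : (0 : ℝ) < ((n : ℝ) + 1)⁻¹ := by positivity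
    linarith
  have hpow : r⁻¹ ^ n ≤ Real.exp 1 := by
    have : r⁻¹ = 1 + (n : ℝ)⁻¹ := by rw [hr_def]; field_simp
    rw [this]
    exact Real.one_add_inv_pow_le_exp
  have hrate : (1 - r) ^ (-β) * (1 - r) ^ (1 - α) ≤ 2 ^ (α + β - 1) * (n : ℝ) ^ (α + β - 1) := by
    rw [← Real.rpow_add (by linarith), hδ, Real.inv_rpow (by positivity),
      ← Real.rpow_neg (by positivity), ← Real.mul_rpow (by norm_num) (by positivity),
      show -(-β + (1 - α)) = α + β - 1 by ring]
    exact Real.rpow_le_rpow (by positivity) (by linarith) (by linarith)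
  calc ‖T ^ n‖ ≤ ((2 * Real.pi)⁻¹ * ∫ θ in 0..2 * Real.pi,
        ‖Ring.inverse (1 - circleMap 0 r θ • T)‖) * r⁻¹ ^ n :=
        hT.norm_pow_le_integral (by linarith) hr1 n
    _ ≤ ((2 * Real.pi)⁻¹ * (C * (2 * 3 ^ α / (α - 1)) *
          (2 ^ (α + β - 1) * (n : ℝ) ^ (α + β - 1)))) * Real.exp 1 := by
        gcongr
        exact (hT.integral_norm_inverse_le hα hr hr1).trans
          (mul_le_mul_of_nonneg_left hrate (by positivity))
    _ = _ := by ring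
end

section
/- Let T be an (α,β)-RK operator on a complex Banach space X with α > 0 and α + β = 1. Then T satisfies the Ritt condition: there exists a constant C' ≥ 1 such that for every λ ∈ ℂ with |λ| > 1 the operator λI − T is invertible and ‖(λI − T)^{-1}‖ ≤ C' / |λ−1|. -/
/-- If `a` and `b` are invertible elements of a normed ring with `‖b - a‖ ‖b⁻¹‖ ≤ 1/2`, then
`‖a⁻¹‖ ≤ 2 ‖b⁻¹‖`. -/
theorem norm_ringInverse_le_two_mul {R : Type*} [NormedRing R] {a b : R} (ha : IsUnit a)
    (hb : IsUnit b) (h : ‖b - a‖ * ‖Ring.inverse b‖ ≤ 1 / 2) :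
    ‖Ring.inverse a‖ ≤ 2 * ‖Ring.inverse b‖ := by
  have key : Ring.inverse a = Ring.inverse b + Ring.inverse a * ((b - a) * Ring.inverse b) := by
    rw [sub_mul, Ring.mul_inverse_cancel b hb, mul_sub, ← mul_assoc, Ring.inverse_mul_cancel a ha]
    simp
  have hprod : ‖Ring.inverse a * ((b - a) * Ring.inverse b)‖ ≤ ‖Ring.inverse a‖ * (1 / 2) :=
    (norm_mul_le _ _).trans
      (mul_le_mul_of_nonneg_left ((norm_mul_le _ _).trans h) (norm_nonneg _))
  have hsum := norm_add_le (Ring.inverse b) (Ring.inverse a * ((b - a) * Ring.inverse b))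
  rw [← key] at hsum
  linarith

/-- Moving radially away from the origin outside the unit disc increases the distance to `1`. -/
theorem norm_sub_one_le_norm_real_mul_sub_one {z : ℂ} (hz : 1 ≤ ‖z‖) {t : ℝ} (ht : 1 ≤ t) :
    ‖z - 1‖ ≤ ‖(t : ℂ) * z - 1‖ := by
  refine le_of_sq_le_sq ?_ (norm_nonneg _)
  have hre : z.re ≤ ‖z‖ := Complex.re_le_norm z
  have hsq : ‖z‖ ^ 2 = z.re * z.re + z.im * z.im := by
    rw [Complex.sq_norm, Complex.normSq_apply]
  rw [Complex.sq_norm, Complex.sq_norm, Complex.normSq_apply, Complex.normSq_apply]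
  simp only [Complex.sub_re, Complex.sub_im, Complex.one_re, Complex.one_im, Complex.re_ofReal_mul,
    Complex.im_ofReal_mul, sub_zero]
  have hfactor : 0 ≤ (t + 1) * ‖z‖ ^ 2 - 2 * z.re := by nlinarith
  have hprod := mul_nonneg (sub_nonneg.2 ht) hfactor
  rw [hsq] at hprod
  nlinarith

/-- An `(α,β)`-RK operator with `α > 0` and `α + β = 1` satisfies the Ritt condition. -/
theorem ritt_of_sum_eq_one
    {X : Type*} [NormedAddCommGroup X] [NormedSpace ℂ X] [CompleteSpace X]
    (T : X →L[ℂ] X) (α β C : ℝ) (hα : 0 < α) (hβ : 0 ≤ β) (hsum : α + β = 1)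
    (hT : IsRK T α β C) :
    ∃ C' : ℝ, 1 ≤ C' ∧ ∀ lam : ℂ, 1 < ‖lam‖ →
      IsUnit (algebraMap ℂ (X →L[ℂ] X) lam - T) ∧
      ‖Ring.inverse (algebraMap ℂ (X →L[ℂ] X) lam - T)‖ ≤ C' / ‖lam - 1‖ := by
  obtain ⟨hC, hRK⟩ := hT
  have h2C : 0 < 2 * C := by linarith
  obtain ⟨ε, hε, hε1, hεα⟩ : ∃ ε : ℝ, 0 < ε ∧ ε ≤ 1 ∧ ε ^ α = (2 * C)⁻¹ := by
    refine ⟨(2 * C)⁻¹ ^ α⁻¹, by positivity, ?_, Real.rpow_inv_rpow (by positivity) hα.ne'⟩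
    exact Real.rpow_le_one (by positivity) (inv_le_one_of_one_le₀ (by linarith)) (by positivity)
  have hεβ : 0 < ε ^ β := Real.rpow_pos_of_pos hε β
  have hεβ1 : ε ^ β ≤ 1 := Real.rpow_le_one hε.le hε1 hβ
  refine ⟨2 * (C / ε ^ β), ?_, fun lam hlam => ⟨(hRK lam hlam).1, ?_⟩⟩
  · have : 1 ≤ C / ε ^ β := by rw [le_div_iff₀ hεβ]; linarith
    linarith
  have hlam0 : 0 < ‖lam‖ := by linarith
  have hd : 0 < ‖lam - 1‖ := by
    rw [norm_pos_iff, sub_ne_zero]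
    rintro rfl
    simp at hlam
  set d := ‖lam - 1‖ with hd_def
  have hs : 0 < ε * d := mul_pos hε hd
  set t : ℝ := 1 + ε * d / ‖lam‖ with ht_def
  have ht : 1 ≤ t := le_add_of_nonneg_right (by positivity)
  have hnorm : ‖(t : ℂ) * lam‖ = ‖lam‖ + ε * d := by
    rw [norm_mul, Complex.norm_real, Real.norm_of_nonneg (by linarith), ht_def]
    field_simp
  have hdist : ‖(t : ℂ) * lam - lam‖ = ε * d := by
    rw [show (t : ℂ) * lam - lam = ((t - 1 : ℝ) : ℂ) * lam by push_cast; ring, norm_mul,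
      Complex.norm_real, Real.norm_of_nonneg (by linarith), ht_def]
    field_simp
    ring
  obtain ⟨hunit, hbound⟩ := hRK ((t : ℂ) * lam) (by rw [hnorm]; linarith)
  have hres : ‖Ring.inverse (algebraMap ℂ (X →L[ℂ] X) ((t : ℂ) * lam) - T)‖ ≤
      C / ε ^ β / d := by
    refine hbound.trans ?_
    rw [hsum, sub_self, Real.rpow_zero, mul_one, div_div]
    have hsplit : ε ^ β * d = d ^ α * (ε * d) ^ β := by
      rw [Real.mul_rpow hε.le hd.le, mul_left_comm, ← Real.rpow_add hd, hsum, Real.rpow_one]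
    rw [hsplit]
    have hle := norm_sub_one_le_norm_real_mul_sub_one hlam.le ht
    have hle' : ε * d ≤ ‖(t : ℂ) * lam‖ - 1 := by rw [hnorm]; linarith
    gcongr
  have hdiff : ‖(algebraMap ℂ (X →L[ℂ] X) ((t : ℂ) * lam) - T) -
      (algebraMap ℂ (X →L[ℂ] X) lam - T)‖ ≤ ε * d := by
    rw [sub_sub_sub_cancel_right, ← map_sub, Algebra.algebraMap_eq_smul_one, norm_smul, hdist]
    exact mul_le_of_le_one_right hs.le ContinuousLinearMap.norm_id_le
  have hhalf : ε * d * (C / ε ^ β / d) = 1 / 2 := by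
    have hε' : ε = ε ^ α * ε ^ β := by rw [← Real.rpow_add hε, hsum, Real.rpow_one]
    calc ε * d * (C / ε ^ β / d) = ε * (C / ε ^ β) := by field_simp
      _ = ε ^ α * ε ^ β * (C / ε ^ β) := by rw [← hε']
      _ = 1 / 2 := by rw [hεα]; field_simp
  have hsmall := (mul_le_mul hdiff hres (norm_nonneg _) hs.le).trans hhalf.le
  refine (norm_ringInverse_le_two_mul (hRK lam hlam).1 hunit hsmall).trans ?_
  rw [mul_div_assoc]
  linarith
end

section
/- Let T be a bounded linear operator on a complex Banach space X and let α ≥ 0. Suppose T is (C,α) bounded, i.e. sup_{n ≥ 0} ‖M_T^α(n)‖ < ∞. Then T is (0,α+1)-RK: there exists a constant C' ≥ 1 such that for every λ ∈ ℂ with |λ| > 1 the operator λI − T is invertible and ‖(λI − T)^{-1}‖ ≤ C' |λ|^α / (|λ|−1)^{α+1}. -/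
/-- The Cesàro numbers `k^α(n)`: `k^α(0) = 1` and `k^α(n) = Γ(n+α)/(Γ(α)Γ(n+1))` for `n ≥ 1`. -/
noncomputable def cesaroNum (α : ℝ) : ℕ → ℝ
  | 0 => 1
  | (n + 1) => Real.Gamma ((n + 1 : ℕ) + α) / (Real.Gamma α * Real.Gamma ((n + 1 : ℕ) + 1))

/-- The Cesàro mean of order `α` of `T`:
`M_T^α(n) = (1/k^(α+1)(n)) Σ_{j=0}^{n} k^α(n−j) T^j`. -/
noncomputable def cesaroMean {X : Type*} [NormedAddCommGroup X] [NormedSpace ℂ X]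
    (T : X →L[ℂ] X) (α : ℝ) (n : ℕ) : X →L[ℂ] X :=
  (cesaroNum (α + 1) n)⁻¹ • ∑ j ∈ Finset.range (n + 1), cesaroNum α (n - j) • T ^ j

theorem cesaroNum_succ_mul {α : ℝ} (hα : 0 ≤ α) (n : ℕ) :
    cesaroNum α (n + 1) * (n + 1) = (α + n) * cesaroNum α n := by
  rcases hα.eq_or_lt with rfl | hα
  · cases n <;> simp [cesaroNum]
  have hΓ : Real.Gamma α ≠ 0 := (Real.Gamma_pos_of_pos hα).ne'
  cases n with
  | zero =>
    simp only [cesaroNum, zero_add, Nat.cast_one, Nat.cast_zero]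
    rw [add_comm 1 α, Real.Gamma_add_one hα.ne', one_add_one_eq_two, Real.Gamma_two]
    field_simp
    ring
  | succ n =>
    have h1 : (0 : ℝ) < ((n + 1 : ℕ) : ℝ) + 1 := by positivity
    have h2 : (0 : ℝ) < ((n + 1 : ℕ) : ℝ) + α := by positivity
    have h3 : Real.Gamma (((n + 1 : ℕ) : ℝ) + 1) ≠ 0 := (Real.Gamma_pos_of_pos h1).ne'
    have e1 : (((n + 1 + 1 : ℕ) : ℝ) + α) = ((n + 1 : ℕ) : ℝ) + α + 1 := by push_cast; ring
    have e2 : (((n + 1 + 1 : ℕ) : ℝ) + 1) = ((n + 1 : ℕ) : ℝ) + 1 + 1 := by push_cast; ring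
    simp only [cesaroNum]
    rw [e1, e2, Real.Gamma_add_one h2.ne', Real.Gamma_add_one h1.ne']
    field_simp
    ring

theorem cesaroNum_eq_multichoose {α : ℝ} (hα : 0 ≤ α) (n : ℕ) :
    cesaroNum α n = Ring.multichoose α n := by
  have key : ∀ m : ℕ, (m.factorial : ℝ) * cesaroNum α m = (ascPochhammer ℝ m).eval α := by
    intro m
    induction m with
    | zero => simp [cesaroNum]
    | succ m ih =>
      rw [ascPochhammer_succ_eval, ← ih, Nat.factorial_succ]
      push_cast
      linear_combination (m.factorial : ℝ) * cesaroNum_succ_mul hα m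
  have h := Ring.factorial_nsmul_multichoose_eq_ascPochhammer α n
  rw [Polynomial.ascPochhammer_smeval_eq_eval, nsmul_eq_mul, ← key n] at h
  exact (mul_left_cancel₀ (by exact_mod_cast n.factorial_ne_zero) h).symm

theorem cesaroNum_pos {α : ℝ} (hα : 0 < α) (n : ℕ) : 0 < cesaroNum α n := by
  cases n with
  | zero => simp [cesaroNum]
  | succ n =>
    exact div_pos (Real.Gamma_pos_of_pos (by positivity))
      (mul_pos (Real.Gamma_pos_of_pos hα) (Real.Gamma_pos_of_pos (by positivity)))

theorem hasSum_cesaroNum_mul_pow {α : ℝ} (hα : 0 ≤ α) {z : ℂ} (hz : ‖z‖ < 1) :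
    HasSum (fun n ↦ (cesaroNum α n : ℂ) * z ^ n) (1 / (1 - z) ^ (α : ℂ)) := by
  have h := (Complex.one_div_one_sub_cpow_hasFPowerSeriesOnBall_zero (α : ℂ)).hasSum
    (y := z) (by
      rw [Metric.mem_eball, edist_zero_right, ← ofReal_norm, ENNReal.ofReal_lt_one]
      exact hz)
  rw [zero_add] at h
  refine (funext fun n ↦ ?_ : (fun n ↦ (cesaroNum α n : ℂ) * z ^ n) = _) ▸ h
  rw [FormalMultilinearSeries.ofScalars_apply_eq, ← Ring.multichoose_eq,
    cesaroNum_eq_multichoose hα]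
  simp only [smul_eq_mul]
  congr 1
  exact Ring.map_multichoose (algebraMap ℝ ℂ) α n

theorem hasSum_cesaroNum_mul_pow_real {α : ℝ} (hα : 0 ≤ α) {r : ℝ} (h0 : 0 ≤ r) (h1 : r < 1) :
    HasSum (fun n ↦ cesaroNum α n * r ^ n) (1 / (1 - r) ^ α) := by
  have h := hasSum_cesaroNum_mul_pow hα (z := (r : ℂ)) (by simpa [abs_of_nonneg h0] using h1)
  rw [← Complex.hasSum_ofReal]
  convert h using 2 with n
  · push_cast; rfl
  · push_cast [Complex.ofReal_cpow (sub_nonneg.mpr h1.le)]; rfl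

/-- The unnormalized Cesàro sums `Σ_{j=0}^{n} k^α(n−j) T^j`. -/
noncomputable def cesaroSum {X : Type*} [NormedAddCommGroup X] [NormedSpace ℂ X]
    (T : X →L[ℂ] X) (α : ℝ) (n : ℕ) : X →L[ℂ] X :=
  ∑ j ∈ Finset.range (n + 1), cesaroNum α (n - j) • T ^ j

section

variable {X : Type*} [NormedAddCommGroup X] [NormedSpace ℂ X] (T : X →L[ℂ] X) (α : ℝ)

theorem cesaroSum_succ (n : ℕ) :
    cesaroSum T α (n + 1) = cesaroSum T α n * T + cesaroNum α (n + 1) • 1 := by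
  simp only [cesaroSum]
  rw [Finset.sum_range_succ', Finset.sum_mul]
  simp [pow_succ]

theorem commute_cesaroSum (n : ℕ) : Commute T (cesaroSum T α n) :=
  Commute.sum_right _ _ _ fun j _ ↦ ((Commute.refl T).pow_right j).smul_right (cesaroNum α (n - j))

variable {T α}

theorem norm_cesaroSum_le (hα : 0 ≤ α) {C : ℝ} (hC : ∀ n, ‖cesaroMean T α n‖ ≤ C) (n : ℕ) :
    ‖cesaroSum T α n‖ ≤ C * cesaroNum (α + 1) n := by
  have hk := cesaroNum_pos (show 0 < α + 1 by linarith) n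
  have h := hC n
  change ‖(cesaroNum (α + 1) n)⁻¹ • cesaroSum T α n‖ ≤ C at h
  rwa [norm_smul, norm_inv, Real.norm_of_nonneg hk.le, inv_mul_le_iff₀ hk, mul_comm] at h

/-- The generating function of the Cesàro sums is `(1 - z)^(-α) (1 - zT)⁻¹`. -/
theorem tsum_cesaroSum_mul (hα : 0 ≤ α) {z : ℂ} (hz : ‖z‖ < 1)
    (hs : Summable fun n ↦ z ^ n • cesaroSum T α n) :
    (∑' n, z ^ n • cesaroSum T α n) * (1 - z • T) =
      (1 / (1 - z) ^ (α : ℂ)) • (1 : X →L[ℂ] X) := by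
  have hA := (hasSum_cesaroNum_mul_pow hα hz).smul_const (1 : X →L[ℂ] X)
  rw [← hA.tsum_eq, hA.summable.tsum_eq_zero_add, mul_sub, mul_one]
  nth_rewrite 1 [hs.tsum_eq_zero_add]
  rw [← hs.tsum_mul_right, add_sub_assoc,
    ← ((summable_nat_add_iff 1).2 hs).tsum_sub (hs.mul_right _)]
  congr 1
  · simp [cesaroSum, cesaroNum]
  · refine tsum_congr fun n ↦ ?_
    rw [cesaroSum_succ, ← Complex.coe_smul, smul_add, smul_smul, mul_comm (z ^ (n + 1)),
      smul_mul_smul_comm, ← pow_succ, add_sub_cancel_left]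

end

/-- A `(C,α)` bounded operator is `(0, α+1)`-RK: there is `C' ≥ 1` such that for all `|λ| > 1`
the operator `λI − T` is invertible and `‖(λI − T)⁻¹‖ ≤ C' |λ|^α / (|λ|−1)^(α+1)`. -/
theorem cesaro_bounded_implies_RK
    {X : Type*} [NormedAddCommGroup X] [NormedSpace ℂ X] [CompleteSpace X]
    (T : X →L[ℂ] X) (α : ℝ) (hα : 0 ≤ α)
    (hC : ∃ C > (0 : ℝ), ∀ n : ℕ, ‖cesaroMean T α n‖ ≤ C) :
    ∃ C' : ℝ, 1 ≤ C' ∧ ∀ lam : ℂ, 1 < ‖lam‖ →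
      IsUnit (algebraMap ℂ (X →L[ℂ] X) lam - T) ∧
      ‖Ring.inverse (algebraMap ℂ (X →L[ℂ] X) lam - T)‖ ≤
        C' * ‖lam‖ ^ α / (‖lam‖ - 1) ^ (α + 1) := by
  obtain ⟨C, hC0, hC⟩ := hC
  refine ⟨max 1 (C * 2 ^ α), le_max_left _ _, fun lam hlam ↦ ?_⟩
  have hl0 : 0 < ‖lam‖ := one_pos.trans hlam
  have hlam0 : lam ≠ 0 := norm_pos_iff.1 hl0
  set z : ℂ := lam⁻¹ with hz_def
  have hzn : ‖z‖ = ‖lam‖⁻¹ := norm_inv lam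
  have hz : ‖z‖ < 1 := hzn ▸ inv_lt_one_of_one_lt₀ hlam
  have hz1 : 1 - z ≠ 0 := by
    intro h
    rw [← sub_eq_zero.1 h, norm_one] at hz
    exact hz.false
  have hmaj : HasSum (fun n ↦ C * (cesaroNum (α + 1) n * ‖z‖ ^ n))
      (C * (1 / (1 - ‖z‖) ^ (α + 1))) :=
    (hasSum_cesaroNum_mul_pow_real (by linarith) (norm_nonneg z) hz).mul_left C
  have hbound : ∀ n, ‖z ^ n • cesaroSum T α n‖ ≤ C * (cesaroNum (α + 1) n * ‖z‖ ^ n) := by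
    intro n
    rw [norm_smul, norm_pow, mul_comm, ← mul_assoc]
    exact mul_le_mul_of_nonneg_right (norm_cesaroSum_le hα hC n) (by positivity)
  have hs : Summable fun n ↦ z ^ n • cesaroSum T α n :=
    Summable.of_norm_bounded hmaj.summable hbound
  set R := ∑' n, z ^ n • cesaroSum T α n with hR_def
  have hR : ‖R‖ ≤ C * (1 / (1 - ‖z‖) ^ (α + 1)) := tsum_of_norm_bounded hmaj hbound
  have hcomm : Commute T R :=
    Commute.tsum_right T fun n ↦ (commute_cesaroSum T α n).smul_right _
  set a : ℂ := (1 - z) ^ (α : ℂ) with ha_def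
  have ha : a ≠ 0 := by simp [ha_def, Complex.cpow_eq_zero_iff, hz1]
  have hgen : R * (1 - z • T) = (1 / a) • 1 := tsum_cesaroSum_mul hα hz hs
  have hfac : algebraMap ℂ (X →L[ℂ] X) lam - T = lam • (1 - z • T) := by
    rw [smul_sub, smul_smul, hz_def, mul_inv_cancel₀ hlam0, one_smul, Algebra.algebraMap_eq_smul_one]
  have hleft : ((z * a) • R) * (algebraMap ℂ (X →L[ℂ] X) lam - T) = 1 := by
    rw [hfac, smul_mul_smul_comm, hgen, smul_smul]
    convert one_smul ℂ (1 : X →L[ℂ] X) using 2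
    rw [hz_def]
    field_simp
  have hcomm' : Commute (algebraMap ℂ (X →L[ℂ] X) lam - T) ((z * a) • R) :=
    (Commute.sub_left (Algebra.commutes lam R) hcomm).smul_right _
  let u : (X →L[ℂ] X)ˣ :=
    ⟨algebraMap ℂ (X →L[ℂ] X) lam - T, (z * a) • R, hcomm'.eq.trans hleft, hleft⟩
  refine ⟨u.isUnit, ?_⟩
  have hinv : Ring.inverse (algebraMap ℂ (X →L[ℂ] X) lam - T) = (z * a) • R :=
    Ring.inverse_unit u
  have han : ‖a‖ ≤ 2 ^ α := by
    rw [ha_def, Complex.norm_cpow_real]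
    refine Real.rpow_le_rpow (norm_nonneg _) ?_ hα
    calc ‖1 - z‖ ≤ ‖(1 : ℂ)‖ + ‖z‖ := norm_sub_le _ _
      _ ≤ 2 := by rw [norm_one]; linarith
  have hpos : 0 < ‖lam‖ - 1 := sub_pos.2 hlam
  have hsub : 1 - ‖z‖ = (‖lam‖ - 1) / ‖lam‖ := by
    rw [hzn]
    field_simp
  rw [hinv, norm_smul, norm_mul]
  calc ‖z‖ * ‖a‖ * ‖R‖ ≤ ‖z‖ * 2 ^ α * (C * (1 / (1 - ‖z‖) ^ (α + 1))) := by gcongr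
    _ = C * 2 ^ α * ‖lam‖ ^ α / (‖lam‖ - 1) ^ (α + 1) := by
      rw [hsub, hzn, Real.div_rpow hpos.le hl0.le, Real.rpow_add_one hl0.ne']
      field_simp
    _ ≤ max 1 (C * 2 ^ α) * ‖lam‖ ^ α / (‖lam‖ - 1) ^ (α + 1) := by
      gcongr
      exact le_max_right _ _
end
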